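/- arXiv:quant-ph/0608024 — 2 statements merged into one kernel-verified Lean document; each statement's English description precedes it below -/
import Mathlib

section
/- Let ψ_1, …, ψ_n be unit vectors in ℂ^d with probability weights p_k ≥ 0 summing to 1 and Π_k = |ψ_k⟩⟨ψ_k|, and suppose the ensemble is a generalized 2-design: Σ_k p_k (Π_k ⊗ Π_k) = (1/(d(d+1)))·(I + SWAP). Then the measure-and-reprepare strategy with POVM elements E_k = d·p_k·Π_k (which indeed form a POVM, since Σ_k d p_k Π_k = I) and reconstruction states σ_k = Π_k achieves average fidelity exactly Σ_{k,i} p_i · Tr(Π_i E_k) · Tr(Π_i σ_k) = 2/(d+1). -/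
open Matrix Kronecker BigOperators
open scoped ComplexOrder

/-- The rank-one projector `|ψ⟩⟨ψ|` onto a vector `ψ ∈ ℂ^d`. -/
noncomputable def proj {d : ℕ} (ψ : Fin d → ℂ) : Matrix (Fin d) (Fin d) ℂ :=
  vecMulVec ψ (star ψ)

/-- The swap operator on `ℂ^d ⊗ ℂ^d`, mapping `u ⊗ v` to `v ⊗ u`. -/
def swapMatrix (d : ℕ) : Matrix (Fin d × Fin d) (Fin d × Fin d) ℂ :=
  Matrix.of fun p q => if p.1 = q.2 ∧ p.2 = q.1 then 1 else 0

theorem trace_proj {d : ℕ} (u : Fin d → ℂ) : (proj u).trace = star u ⬝ᵥ u := by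
  rw [proj, trace_vecMulVec, dotProduct_comm]

theorem trace_proj_mul_proj {d : ℕ} (u v : Fin d → ℂ) :
    (proj u * proj v).trace = (Complex.normSq (star u ⬝ᵥ v) : ℂ) := by
  have h' : u ⬝ᵥ star v = star (star u ⬝ᵥ v) := by
    rw [dotProduct_star, dotProduct_comm]
  rw [proj, proj, vecMulVec_mul_vecMulVec, trace_vecMulVec, dotProduct_smul, h', smul_eq_mul,
    Complex.normSq_eq_conj_mul_self, starRingEnd_apply, mul_comm]

theorem trace_swapMatrix_mul_kronecker {d : ℕ} (A B : Matrix (Fin d) (Fin d) ℂ) :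
    (swapMatrix d * (A ⊗ₖ B)).trace = (A * B).trace := by
  simp only [trace, diag_apply, mul_apply, Fintype.sum_prod_type, swapMatrix, of_apply,
    kroneckerMap_apply, ite_and, ite_mul, one_mul, zero_mul, Finset.sum_ite_eq,
    Finset.mem_univ, if_true]
  rw [Finset.sum_comm]

/-- For a generalized 2-design, the measure-and-reprepare
strategy with POVM elements `E k = d * p k • Π k` (which indeed form a POVM)
and reconstruction states `σ k = Π k` achieves average fidelity
exactly `2/(d+1)`. -/
theorem measure_and_reprepare_fidelity_of_gen_two_design {d n : ℕ}
    (ψ : Fin n → Fin d → ℂ) (hψ : ∀ i, star (ψ i) ⬝ᵥ ψ i = 1)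
    (p : Fin n → ℝ) (hp : ∀ i, 0 ≤ p i) (hp1 : ∑ i, p i = 1)
    (hdesign : ∑ i, (p i : ℂ) • (proj (ψ i) ⊗ₖ proj (ψ i)) =
      (1 / ((d : ℂ) * (d + 1))) • (1 + swapMatrix d)) :
    (∀ k, (((d : ℂ) * (p k : ℂ)) • proj (ψ k)).PosSemidef) ∧
    (∑ k, ((d : ℂ) * (p k : ℂ)) • proj (ψ k) = 1) ∧
    ∑ k, ∑ i, p i * (proj (ψ i) * (((d : ℂ) * (p k : ℂ)) • proj (ψ k))).trace.re *
        (proj (ψ i) * proj (ψ k)).trace.re = 2 / ((d : ℝ) + 1) := by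
  have hn : (Finset.univ : Finset (Fin n)).Nonempty := by
    by_contra h
    rw [Finset.not_nonempty_iff_eq_empty] at h
    simp [h] at hp1
  have hd : d ≠ 0 := by
    rintro rfl
    obtain ⟨i, -⟩ := hn
    simpa using hψ i
  have hdC : (d : ℂ) ≠ 0 := Nat.cast_ne_zero.mpr hd
  have hd1C : (d : ℂ) + 1 ≠ 0 := Nat.cast_add_one_ne_zero d
  refine ⟨fun k => ?_, ?_, ?_⟩
  · refine (posSemidef_vecMulVec_self_star (ψ k)).smul ?_
    exact mul_nonneg (Nat.cast_nonneg d) (Complex.zero_le_real.mpr (hp k))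
  · ext a b
    have h : ∑ c, ∑ i, (p i : ℂ) * (proj (ψ i) a b * proj (ψ i) c c) =
        ∑ c, 1 / ((d : ℂ) * (d + 1)) *
          ((1 : Matrix (Fin d × Fin d) (Fin d × Fin d) ℂ) (a, c) (b, c) +
            swapMatrix d (a, c) (b, c)) := by
      refine Finset.sum_congr rfl fun c _ => ?_
      simpa [Matrix.sum_apply] using congrFun (congrFun hdesign (a, c)) (b, c)
    have hl : ∑ c, ∑ i, (p i : ℂ) * (proj (ψ i) a b * proj (ψ i) c c) =
        ∑ i, (p i : ℂ) * proj (ψ i) a b := by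
      rw [Finset.sum_comm]
      refine Finset.sum_congr rfl fun i _ => ?_
      have ht : ∑ c, proj (ψ i) c c = 1 := (trace_proj (ψ i)).trans (hψ i)
      rw [← Finset.mul_sum, ← Finset.mul_sum, ht, mul_one]
    have hr : ∑ c, ((1 : Matrix (Fin d × Fin d) (Fin d × Fin d) ℂ) (a, c) (b, c) +
        swapMatrix d (a, c) (b, c)) = (d + 1) * (1 : Matrix (Fin d) (Fin d) ℂ) a b := by
      by_cases hab : a = b
      · subst hab
        simp [Finset.sum_add_distrib, swapMatrix, eq_comm]
      · have : ∀ c, ¬ (a = c ∧ c = b) := fun c hc => hab (hc.1.trans hc.2)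
        simp [swapMatrix, hab, this]
    rw [hl, ← Finset.mul_sum, hr] at h
    simp only [Matrix.sum_apply, Matrix.smul_apply, smul_eq_mul, mul_assoc, ← Finset.mul_sum]
    rw [h]
    field_simp
  · have key : ∀ k, ∑ i, p i * Complex.normSq (star (ψ i) ⬝ᵥ ψ k) ^ 2 =
        2 / ((d : ℝ) * (d + 1)) := by
      intro k
      have h := congrArg (fun M => (M * (proj (ψ k) ⊗ₖ proj (ψ k))).trace) hdesign
      simp only [Finset.sum_mul, trace_sum, smul_mul, trace_smul, ← mul_kronecker_mul,
        trace_kronecker, add_mul, one_mul, trace_add, trace_swapMatrix_mul_kronecker,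
        trace_proj_mul_proj, trace_proj, hψ, smul_eq_mul, map_one, Complex.ofReal_one] at h
      apply Complex.ofReal_injective
      push_cast
      simp only [pow_two]
      rw [h]
      ring
    calc _ = ∑ k, d * p k * ∑ i, p i * Complex.normSq (star (ψ i) ⬝ᵥ ψ k) ^ 2 := by
          refine Finset.sum_congr rfl fun k _ => ?_
          rw [Finset.mul_sum]
          refine Finset.sum_congr rfl fun i _ => ?_
          rw [Matrix.mul_smul, trace_smul, trace_proj_mul_proj, smul_eq_mul]
          norm_cast
          ring
      _ = 2 / ((d : ℝ) + 1) := by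
          simp only [key]
          rw [← Finset.sum_mul, ← Finset.mul_sum, hp1]
          have : (d : ℝ) ≠ 0 := Nat.cast_ne_zero.mpr hd
          field_simp
end

section
/- Let μ be the uniform (normalized) probability measure on the unit sphere of ℂ^d, and for a unit vector ψ write P_ψ = |ψ⟩⟨ψ|. Then for every linear operator A on ℂ^d, ∫ P_ψ A P_ψ dμ(ψ) = (1/(d(d+1)))·(A + Tr(A)·I). -/
open Matrix BigOperators MeasureTheory

/-- The real reflection `(x, y) ↦ (α x + β y, β x - α y)` in the coordinates `i`, `j`. -/
theorem exists_unitary_reflection {d : ℕ} {i j : Fin d} (hij : i ≠ j) {α β : ℝ}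
    (h : α ^ 2 + β ^ 2 = 1) :
    ∃ U : Matrix.unitaryGroup (Fin d) ℂ, ∀ ψ : Fin d → ℂ,
      ((U : Matrix (Fin d) (Fin d) ℂ) *ᵥ ψ) i = α * ψ i + β * ψ j ∧
      ((U : Matrix (Fin d) (Fin d) ℂ) *ᵥ ψ) j = β * ψ i - α * ψ j := by
  have hc : (α : ℂ) ^ 2 + (β : ℂ) ^ 2 = 1 := by exact_mod_cast h
  let D : Fin d → ℂ := fun p => if p = i then α else if p = j then -α else 1
  let M : Matrix (Fin d) (Fin d) ℂ :=
    diagonal D + (Matrix.single i j (β : ℂ) + Matrix.single j i (β : ℂ))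
  have hMv (ψ : Fin d → ℂ) (p : Fin d) : (M *ᵥ ψ) p =
      if p = i then α * ψ i + β * ψ j else if p = j then β * ψ i - α * ψ j else ψ p := by
    simp only [M, D, add_mulVec, Pi.add_apply, mulVec_diagonal, single_mulVec, Function.update_apply]
    split_ifs <;> simp_all
    ring
  have hstar : star M = M := by
    rw [star_eq_conjTranspose]
    simp only [M, conjTranspose_add, diagonal_conjTranspose, conjTranspose_single]
    have : star D = D := by
      ext p
      simp only [D, Pi.star_apply]
      split_ifs <;> simp
    rw [this]
    simp [add_comm]
  have hsq : M * M = 1 := by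
    refine Matrix.ext_of_mulVec_single fun q => ?_
    ext p
    rw [← mulVec_mulVec, one_mulVec, hMv, hMv, hMv, hMv]
    split_ifs with h1 h2 <;> simp_all <;> grind
  refine ⟨⟨M, ?_⟩, fun ψ => ⟨?_, ?_⟩⟩
  · rw [mem_unitaryGroup_iff, hstar, hsq]
  · simp [hMv]
  · simp [hMv, hij.symm]

/-- Multiplication of the coordinate `k` by the imaginary unit. -/
theorem exists_unitary_phase {d : ℕ} (k : Fin d) :
    ∃ U : Matrix.unitaryGroup (Fin d) ℂ, ∀ (ψ : Fin d → ℂ) (p : Fin d),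
      ((U : Matrix (Fin d) (Fin d) ℂ) *ᵥ ψ) p = (if p = k then Complex.I else 1) * ψ p := by
  refine ⟨⟨diagonal fun p => if p = k then Complex.I else 1, ?_⟩,
    fun ψ p => by simp [mulVec_diagonal]⟩
  rw [mem_unitaryGroup_iff, star_eq_conjTranspose, diagonal_conjTranspose, diagonal_mul_diagonal,
    ← diagonal_one]
  congr 1
  ext p
  by_cases h : p = k <;> simp [h]

/-- The monomial `ψ̄ k * ψ l * ψ i * ψ̄ j` whose integrals are the fourth moments. -/
noncomputable def quarticMonomial {d : ℕ} (k l i j : Fin d) (ψ : Fin d → ℂ) : ℂ :=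
  star (ψ k) * ψ l * ψ i * star (ψ j)

theorem measurable_quarticMonomial {d : ℕ} (k l i j : Fin d) :
    Measurable (quarticMonomial k l i j) := by
  have : Continuous (quarticMonomial k l i j) := by
    unfold quarticMonomial
    fun_prop
  exact this.measurable

section Moments

variable {d : ℕ} {μ : Measure (Fin d → ℂ)}

theorem norm_apply_le_one_of_star_dotProduct {ψ : Fin d → ℂ} (h : star ψ ⬝ᵥ ψ = 1) (k : Fin d) :
    ‖ψ k‖ ≤ 1 := by
  have h1 : ∑ p, ‖ψ p‖ ^ 2 = 1 := by
    have h2 : ((∑ p, ‖ψ p‖ ^ 2 : ℝ) : ℂ) = 1 := by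
      rw [← h]
      simp [dotProduct, Complex.conj_mul']
    exact_mod_cast h2
  have h3 : ‖ψ k‖ ^ 2 ≤ ∑ p, ‖ψ p‖ ^ 2 :=
    Finset.single_le_sum (f := fun p => ‖ψ p‖ ^ 2) (fun p _ => by positivity) (Finset.mem_univ k)
  nlinarith [norm_nonneg (ψ k)]

theorem integrable_quarticMonomial [IsProbabilityMeasure μ]
    (hsph : ∀ᵐ ψ ∂μ, star ψ ⬝ᵥ ψ = 1) (k l i j : Fin d) :
    Integrable (quarticMonomial k l i j) μ := by
  refine Integrable.of_bound (measurable_quarticMonomial k l i j).aestronglyMeasurable 1 ?_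
  filter_upwards [hsph] with ψ hψ
  have h := norm_apply_le_one_of_star_dotProduct hψ
  simp only [quarticMonomial, norm_mul, norm_star]
  exact mul_le_one₀ (mul_le_one₀ (mul_le_one₀ (h k) (norm_nonneg _) (h l)) (norm_nonneg _) (h i))
    (norm_nonneg _) (h j)

theorem integral_quarticMonomial_mulVec
    (hinv : ∀ U : Matrix.unitaryGroup (Fin d) ℂ,
      μ.map (fun ψ => (U : Matrix (Fin d) (Fin d) ℂ) *ᵥ ψ) = μ)
    (U : Matrix.unitaryGroup (Fin d) ℂ) (k l i j : Fin d) :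
    ∫ ψ, quarticMonomial k l i j ((U : Matrix (Fin d) (Fin d) ℂ) *ᵥ ψ) ∂μ =
      ∫ ψ, quarticMonomial k l i j ψ ∂μ := by
  have hU : Continuous fun ψ : Fin d → ℂ => (U : Matrix (Fin d) (Fin d) ℂ) *ᵥ ψ := by fun_prop
  conv_rhs => rw [← hinv U]
  rw [integral_map hU.aemeasurable (measurable_quarticMonomial k l i j).aestronglyMeasurable]

theorem integral_quarticMonomial_eq_zero
    (hinv : ∀ U : Matrix.unitaryGroup (Fin d) ℂ,
      μ.map (fun ψ => (U : Matrix (Fin d) (Fin d) ℂ) *ᵥ ψ) = μ)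
    {k l i j : Fin d} (h : ¬ ((k = l ∧ i = j) ∨ (k = i ∧ l = j))) :
    ∫ ψ, quarticMonomial k l i j ψ ∂μ = 0 := by
  by_contra h0
  have phase (m : Fin d) :
      star (if k = m then Complex.I else 1) * (if l = m then Complex.I else 1) *
      (if i = m then Complex.I else 1) * star (if j = m then Complex.I else 1) = 1 := by
    obtain ⟨U, hU⟩ := exists_unitary_phase m
    have h1 := integral_quarticMonomial_mulVec hinv U k l i j
    refine mul_right_cancel₀ h0 ?_
    rw [one_mul, ← integral_const_mul]
    conv_rhs => rw [← h1]
    congr 1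
    ext ψ
    simp only [quarticMonomial, hU, star_mul']
    ring
  have hk := phase k
  have hj := phase j
  clear phase h0
  split_ifs at hk hj <;> simp [Complex.ext_iff] at hk hj <;> grind

theorem integral_quarticMonomial_reflection [IsProbabilityMeasure μ]
    (hsph : ∀ᵐ ψ ∂μ, star ψ ⬝ᵥ ψ = 1)
    (hinv : ∀ U : Matrix.unitaryGroup (Fin d) ℂ,
      μ.map (fun ψ => (U : Matrix (Fin d) (Fin d) ℂ) *ᵥ ψ) = μ)
    {i j : Fin d} (hij : i ≠ j) :
    ∫ ψ, quarticMonomial i i i i ψ ∂μ = 2 * ∫ ψ, quarticMonomial i i j j ψ ∂μ := by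
  have hI := integrable_quarticMonomial hsph
  have hswap : ∫ ψ, quarticMonomial j j j j ψ ∂μ = ∫ ψ, quarticMonomial i i i i ψ ∂μ := by
    obtain ⟨U, hU⟩ := exists_unitary_reflection hij (α := 0) (β := 1) (by norm_num)
    rw [← integral_quarticMonomial_mulVec hinv U i i i i]
    congr 1
    ext ψ
    simp [quarticMonomial, hU]
  obtain ⟨U, hU⟩ := exists_unitary_reflection hij (α := 3 / 5) (β := 4 / 5) (by norm_num)
  have hrot := integral_quarticMonomial_mulVec hinv U i i j j
  have hexp (ψ : Fin d → ℂ) :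
      quarticMonomial i i j j ((U : Matrix (Fin d) (Fin d) ℂ) *ᵥ ψ) =
        (144 / 625 : ℂ) * quarticMonomial i i i i ψ + (84 / 625 : ℂ) * quarticMonomial i i i j ψ +
        (-144 / 625 : ℂ) * quarticMonomial j i i j ψ + (84 / 625 : ℂ) * quarticMonomial i i j i ψ +
        (49 / 625 : ℂ) * quarticMonomial i i j j ψ + (-84 / 625 : ℂ) * quarticMonomial j i j j ψ +
        (-144 / 625 : ℂ) * quarticMonomial i j j i ψ + (-84 / 625 : ℂ) * quarticMonomial i j j j ψ +
        (144 / 625 : ℂ) * quarticMonomial j j j j ψ := by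
    simp only [quarticMonomial, hU, star_add, star_sub, star_mul', Complex.star_def,
      Complex.conj_ofReal]
    push_cast
    ring
  simp_rw [hexp] at hrot
  simp (disch := fun_prop) only [integral_add, integral_const_mul] at hrot
  rw [integral_quarticMonomial_eq_zero hinv (k := i) (l := i) (i := i) (j := j) (by grind),
    integral_quarticMonomial_eq_zero hinv (k := j) (l := i) (i := i) (j := j) (by grind),
    integral_quarticMonomial_eq_zero hinv (k := i) (l := i) (i := j) (j := i) (by grind),
    integral_quarticMonomial_eq_zero hinv (k := j) (l := i) (i := j) (j := j) (by grind),
    integral_quarticMonomial_eq_zero hinv (k := i) (l := j) (i := j) (j := i) (by grind),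
    integral_quarticMonomial_eq_zero hinv (k := i) (l := j) (i := j) (j := j) (by grind),
    hswap] at hrot
  linear_combination (625 / 288) * hrot

theorem integral_quarticMonomial_pair [IsProbabilityMeasure μ]
    (hsph : ∀ᵐ ψ ∂μ, star ψ ⬝ᵥ ψ = 1)
    (hinv : ∀ U : Matrix.unitaryGroup (Fin d) ℂ,
      μ.map (fun ψ => (U : Matrix (Fin d) (Fin d) ℂ) *ᵥ ψ) = μ)
    (i j : Fin d) :
    ∫ ψ, quarticMonomial i i j j ψ ∂μ =
      1 / ((d : ℂ) * (d + 1)) * (1 + if i = j then 1 else 0) := by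
  have hI := integrable_quarticMonomial hsph
  obtain ⟨a, ha⟩ : ∃ a, ∀ p, ∫ ψ, quarticMonomial p p p p ψ ∂μ = a := by
    refine ⟨∫ ψ, quarticMonomial i i i i ψ ∂μ, fun p => ?_⟩
    rcases eq_or_ne p i with rfl | hp
    · rfl
    · rw [integral_quarticMonomial_reflection hsph hinv hp,
        integral_quarticMonomial_reflection hsph hinv hp.symm]
      congr 3
      ext ψ
      simp only [quarticMonomial]
      ring
  have hpair (p q : Fin d) : ∫ ψ, quarticMonomial p p q q ψ ∂μ =
      a / 2 * (1 + if p = q then 1 else 0) := by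
    split_ifs with h
    · subst h
      rw [ha]
      ring
    · rw [← ha p, integral_quarticMonomial_reflection hsph hinv h]
      ring
  have htotal : ∑ p, ∑ q, ∫ ψ, quarticMonomial p p q q ψ ∂μ = 1 := by
    simp_rw [← integral_finsetSum Finset.univ fun q _ => hI _ _ _ q]
    rw [← integral_finsetSum _ fun p _ => integrable_finsetSum _ fun q _ => hI _ _ _ _]
    have : (fun ψ : Fin d → ℂ => ∑ p, ∑ q, quarticMonomial p p q q ψ) =ᵐ[μ] fun _ => 1 := by
      filter_upwards [hsph] with ψ hψ
      calc ∑ p, ∑ q, quarticMonomial p p q q ψ = (star ψ ⬝ᵥ ψ) * (star ψ ⬝ᵥ ψ) := by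
            simp only [quarticMonomial, dotProduct, Finset.sum_mul_sum, Pi.star_apply]
            exact Finset.sum_congr rfl fun p _ => Finset.sum_congr rfl fun q _ => by ring
        _ = 1 := by rw [hψ, one_mul]
    rw [integral_congr_ae this]
    simp
  simp_rw [hpair, ← Finset.mul_sum, Finset.sum_add_distrib, Finset.sum_ite_eq] at htotal
  simp only [Finset.sum_const, Finset.card_univ, Fintype.card_fin, Finset.mem_univ, if_true,
    nsmul_eq_mul, mul_one] at htotal
  rw [hpair i j]
  congr 1
  refine eq_one_div_of_mul_eq_one_left ?_
  linear_combination htotal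

theorem integral_quarticMonomial [IsProbabilityMeasure μ]
    (hsph : ∀ᵐ ψ ∂μ, star ψ ⬝ᵥ ψ = 1)
    (hinv : ∀ U : Matrix.unitaryGroup (Fin d) ℂ,
      μ.map (fun ψ => (U : Matrix (Fin d) (Fin d) ℂ) *ᵥ ψ) = μ)
    (k l i j : Fin d) :
    ∫ ψ, quarticMonomial k l i j ψ ∂μ = 1 / ((d : ℂ) * (d + 1)) *
      ((if k = l ∧ i = j then 1 else 0) + if k = i ∧ l = j then 1 else 0) := by
  by_cases h : (k = l ∧ i = j) ∨ (k = i ∧ l = j)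
  · rcases h with ⟨rfl, rfl⟩ | ⟨rfl, rfl⟩
    · rw [integral_quarticMonomial_pair hsph hinv]
      simp
    · have hcomm : quarticMonomial k l k l = quarticMonomial k k l l := by
        ext ψ
        simp only [quarticMonomial]
        ring
      rw [hcomm, integral_quarticMonomial_pair hsph hinv]
      simp [add_comm]
  · rw [integral_quarticMonomial_eq_zero hinv h]
    rw [not_or] at h
    simp [h.1, h.2]

end Moments

/-- Let `μ` be the uniform probability measure on the unit
sphere of `ℂ^d`. Then for every operator `A` on `ℂ^d`, entrywise,
`∫ P_ψ A P_ψ dμ(ψ) = (1/(d(d+1)))·(A + Tr(A)·I)`, where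
`P_ψ A P_ψ = ⟨ψ, A ψ⟩ · |ψ⟩⟨ψ|` has `(i,j)` entry
`⟨ψ, A ψ⟩ * ψ i * conj (ψ j)`. -/
theorem integral_proj_conj_sphere {d : ℕ}
    (μ : Measure (Fin d → ℂ)) [IsProbabilityMeasure μ]
    (hsph : ∀ᵐ ψ ∂μ, star ψ ⬝ᵥ ψ = 1)
    (hinv : ∀ U : Matrix.unitaryGroup (Fin d) ℂ,
      μ.map (fun ψ => (U : Matrix (Fin d) (Fin d) ℂ) *ᵥ ψ) = μ)
    (A : Matrix (Fin d) (Fin d) ℂ) :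
    ∀ i j : Fin d,
      (∫ ψ, (star ψ ⬝ᵥ (A *ᵥ ψ)) * (ψ i * (starRingEnd ℂ) (ψ j)) ∂μ) =
        (1 / ((d : ℂ) * (d + 1))) * (A i j + A.trace * (if i = j then 1 else 0)) := by
  intro i j
  have hI := integrable_quarticMonomial hsph
  have hexp (ψ : Fin d → ℂ) : (star ψ ⬝ᵥ (A *ᵥ ψ)) * (ψ i * (starRingEnd ℂ) (ψ j)) =
      ∑ k, ∑ l, A k l * quarticMonomial k l i j ψ := by
    simp only [dotProduct, mulVec, quarticMonomial, Finset.sum_mul, Finset.mul_sum, Pi.star_apply,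
      Complex.star_def]
    exact Finset.sum_congr rfl fun k _ => Finset.sum_congr rfl fun l _ => by ring
  simp_rw [hexp]
  have hsum : ∫ ψ, ∑ k, ∑ l, A k l * quarticMonomial k l i j ψ ∂μ =
      ∑ k, ∑ l, A k l * ∫ ψ, quarticMonomial k l i j ψ ∂μ := by
    rw [integral_finsetSum]
    · refine Finset.sum_congr rfl fun k _ => ?_
      rw [integral_finsetSum]
      · exact Finset.sum_congr rfl fun l _ => integral_const_mul _ _
      · exact fun l _ => (hI k l i j).const_mul _
    · exact fun k _ => integrable_finsetSum _ fun l _ => (hI k l i j).const_mul _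
  rw [hsum]
  simp_rw [integral_quarticMonomial hsph hinv, mul_left_comm (A _ _), ← Finset.mul_sum]
  congr 1
  simp only [mul_add, Finset.sum_add_distrib, ite_and, trace, diag_apply]
  simp [add_comm, Finset.sum_ite_eq]
end
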